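/- Let (X, f_{0,∞}) be a non-autonomous dynamical system on a compact metric space and let F be a Furstenberg family. Then (X, f_{0,∞}) is multi-F-sensitive if and only if the induced hyperspace system (K(X), \bar f_{0,∞}) is multi-F-sensitive. -/

import Mathlib

open Filter Topology TopologicalSpace

/-- `comps f n` is `f_0^n = f_{n-1} ∘ ⋯ ∘ f_0`. -/
def comps {X : Type*} (f : ℕ → X → X) : ℕ → X → X
  | 0 => id
  | n + 1 => f n ∘ comps f n

/-- `F` is a (proper) Furstenberg family of subsets of `ℕ`: hereditary upwards,
`∅ ∉ F` and `ℕ ∈ F`. -/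
def FurstenbergFamily (F : Set (Set ℕ)) : Prop :=
  (∀ A B : Set ℕ, A ⊆ B → A ∈ F → B ∈ F) ∧ ∅ ∉ F ∧ Set.univ ∈ F

/-- `N(x, ε, δ)`: the set of times `n ≥ 1` for which some `y` with `dist x y < ε`
satisfies `dist (f_0^n(x), f_0^n(y)) > δ`. -/
def sensTimes {X : Type*} [MetricSpace X] (f : ℕ → X → X) (x : X) (ε δ : ℝ) : Set ℕ :=
  {n | 1 ≤ n ∧ ∃ y : X, dist x y < ε ∧ δ < dist (comps f n x) (comps f n y)}

/-- The system `f` is multi-`F`-sensitive: there is a sensitivity constant `δ > 0`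
such that `⋂_{i=1}^k N(x_i, ε, δ) ∈ F` for all `k ≥ 1`, all points `x_1, …, x_k`
and all `ε > 0`. -/
def MultiSensitive {X : Type*} [MetricSpace X] (f : ℕ → X → X) (F : Set (Set ℕ)) : Prop :=
  ∃ δ > (0 : ℝ), ∀ k : ℕ, 1 ≤ k → ∀ x : Fin k → X, ∀ ε > (0 : ℝ),
    (⋂ i : Fin k, sensTimes f (x i) ε δ) ∈ F

theorem coe_comps_aux {X : Type*} [MetricSpace X]
    (f : ℕ → X → X) (G : ℕ → NonemptyCompacts X → NonemptyCompacts X)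
    (hG : ∀ n (K : NonemptyCompacts X), (G n K : Set X) = f n '' ↑K)
    (n : ℕ) (K : NonemptyCompacts X) : ((comps G n K : NonemptyCompacts X) : Set X) = comps f n '' ↑K := by
  induction n with
  | zero => simp [comps]
  | succ n ih =>
    simp only [comps, Function.comp_apply, hG, ih, Set.image_image]

theorem nc_ne_top_aux {X : Type*} [MetricSpace X] (A B : NonemptyCompacts X) :
    Metric.hausdorffEDist (A : Set X) B ≠ ⊤ :=
  Metric.hausdorffEDist_ne_top_of_nonempty_of_bounded A.nonempty B.nonempty
    A.isCompact.isBounded B.isCompact.isBounded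

theorem finset_aux {X : Type*} [MetricSpace X] (f : ℕ → X → X) (F : Set (Set ℕ)) (δ : ℝ)
    (h : ∀ k : ℕ, 1 ≤ k → ∀ x : Fin k → X, ∀ ε > (0 : ℝ),
      (⋂ i : Fin k, sensTimes f (x i) ε δ) ∈ F)
    (T : Finset X) (hT : T.Nonempty) (ε : ℝ) (hε : 0 < ε) :
    {n | ∀ x ∈ T, n ∈ sensTimes f x ε δ} ∈ F := by
  have := h T.card hT.card_pos (fun i => (T.equivFin.symm i : X)) ε hε
  convert this using 1
  ext n
  simp only [Set.mem_ofPred_eq, Set.mem_iInter]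
  constructor
  · intro hn i
    exact hn _ (T.equivFin.symm i).2
  · intro hn x hx
    simpa using hn (T.equivFin ⟨x, hx⟩)

theorem forward_aux {X : Type*} [MetricSpace X]
    (f : ℕ → X → X) (G : ℕ → NonemptyCompacts X → NonemptyCompacts X)
    (hG : ∀ n (K : NonemptyCompacts X), (G n K : Set X) = f n '' ↑K)
    (A : NonemptyCompacts X) (ε δ : ℝ) (hε : 0 < ε) (hδ : 0 < δ) (S : Set X)
    (hSA : S ⊆ A) (hfin : S.Finite) (hne : S.Nonempty)
    (hcov : ∀ a ∈ A, ∃ s ∈ S, dist a s < ε / 3) (n : ℕ)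
    (hn : ∀ x ∈ S, n ∈ sensTimes f x (ε / 3) δ) : n ∈ sensTimes G A ε (δ / 4) := by
  obtain ⟨p, hp⟩ := hne
  have hz : ∀ s : X, ∃ z : X, s ∈ S →
      dist s z < ε / 3 ∧ δ / 2 ≤ dist (comps f n p) (comps f n z) := by
    intro s
    by_cases hs : s ∈ S
    · obtain ⟨-, y, hy, hd⟩ := hn s hs
      by_cases hc : δ / 2 ≤ dist (comps f n p) (comps f n s)
      · exact ⟨s, fun _ => ⟨by rw [dist_self]; positivity, hc⟩⟩
      · refine ⟨y, fun _ => ⟨hy, ?_⟩⟩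
        have := dist_triangle_left (comps f n s) (comps f n y) (comps f n p)
        linarith
    · exact ⟨s, fun h => absurd h hs⟩
  choose z hz using hz
  let B : NonemptyCompacts X := ⟨⟨z '' S, (hfin.image z).isCompact⟩, ⟨z p, p, hp, rfl⟩⟩
  have hB : (B : Set X) = z '' S := rfl
  refine ⟨(hn p hp).1, B, ?_, ?_⟩
  · rw [Metric.NonemptyCompacts.dist_eq]
    refine lt_of_le_of_lt (b := 2 * ε / 3)
      (Metric.hausdorffDist_le_of_mem_dist (by positivity) ?_ ?_) (by linarith)
    · intro a ha
      obtain ⟨s, hs, has⟩ := hcov a ha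
      refine ⟨z s, ⟨s, hs, rfl⟩, ?_⟩
      have := dist_triangle a s (z s)
      have := (hz s hs).1
      linarith
    · rintro _ ⟨s, hs, rfl⟩
      refine ⟨s, hSA hs, ?_⟩
      have := (hz s hs).1
      rw [dist_comm]
      linarith
  · rw [Metric.NonemptyCompacts.dist_eq]
    by_contra! hcon
    have hmem : comps f n p ∈ ((comps G n A : NonemptyCompacts X) : Set X) := by
      rw [coe_comps_aux f G hG]
      exact ⟨p, hSA hp, rfl⟩
    obtain ⟨w, hw, hd⟩ := Metric.exists_dist_lt_of_hausdorffDist_lt hmem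
      (lt_of_le_of_lt hcon (by linarith : δ / 4 < δ / 2)) (nc_ne_top_aux _ _)
    rw [coe_comps_aux f G hG, hB] at hw
    obtain ⟨_, ⟨s, hs, rfl⟩, rfl⟩ := hw
    have := (hz s hs).2
    linarith

theorem backward_aux {X : Type*} [MetricSpace X]
    (f : ℕ → X → X) (G : ℕ → NonemptyCompacts X → NonemptyCompacts X)
    (hG : ∀ n (K : NonemptyCompacts X), (G n K : Set X) = f n '' ↑K)
    (x : X) (ε δ : ℝ) (hδ : 0 < δ) (n : ℕ)
    (hn : n ∈ sensTimes G {x} ε δ) : n ∈ sensTimes f x ε δ := by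
  obtain ⟨h1, K, hK, hd⟩ := hn
  refine ⟨h1, ?_⟩
  by_contra! hcon
  rw [Metric.NonemptyCompacts.dist_eq] at hK hd
  have hy : ∀ y ∈ (K : Set X), dist (comps f n x) (comps f n y) ≤ δ := by
    intro y hy
    apply hcon
    obtain ⟨w, hw, hwd⟩ := Metric.exists_dist_lt_of_hausdorffDist_lt' hy hK (nc_ne_top_aux _ _)
    rw [NonemptyCompacts.coe_singleton, Set.mem_singleton_iff] at hw
    exact hw ▸ hwd
  refine absurd hd (not_lt.2 (Metric.hausdorffDist_le_of_mem_dist hδ.le ?_ ?_))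
  · rw [coe_comps_aux f G hG, coe_comps_aux f G hG, NonemptyCompacts.coe_singleton]
    rintro _ ⟨_, rfl, rfl⟩
    obtain ⟨y, hyK⟩ := K.nonempty
    exact ⟨_, ⟨y, hyK, rfl⟩, hy y hyK⟩
  · rw [coe_comps_aux f G hG, coe_comps_aux f G hG, NonemptyCompacts.coe_singleton]
    rintro _ ⟨y, hyK, rfl⟩
    exact ⟨_, ⟨x, rfl, rfl⟩, by rw [dist_comm]; exact hy y hyK⟩

theorem net_aux {X : Type*} [MetricSpace X] (A : NonemptyCompacts X) (ε : ℝ) (hε : 0 < ε) :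
    ∃ S : Finset X, (S : Set X) ⊆ A ∧ S.Nonempty ∧ ∀ a ∈ A, ∃ s ∈ S, dist a s < ε := by
  obtain ⟨t, htA, hfin, hcov⟩ := A.isCompact.finite_cover_balls hε
  have hc : ∀ a ∈ A, ∃ s ∈ hfin.toFinset, dist a s < ε := by
    intro a ha
    simpa using hcov ha
  refine ⟨hfin.toFinset, by simpa using htA, ?_, hc⟩
  obtain ⟨a, ha⟩ := A.nonempty
  obtain ⟨s, hs, -⟩ := hc a ha
  exact ⟨s, hs⟩

/-- Let `F` be a Furstenberg family. Then `(X, f_{0,∞})` is multi-`F`-sensitive iff the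
induced hyperspace system `(K(X), \bar f_{0,∞})` is multi-`F`-sensitive, where `K(X)` is
the space of nonempty compact subsets of `X` with the Hausdorff metric and `G n` is the
induced map, characterized by `G n K = f n '' K`. -/
theorem multiSensitive_iff_hyperspace {X : Type*} [MetricSpace X] [CompactSpace X]
    (f : ℕ → X → X) (hf : ∀ n, Continuous (f n))
    (F : Set (Set ℕ)) (hFam : FurstenbergFamily F)
    (G : ℕ → NonemptyCompacts X → NonemptyCompacts X)
    (hG : ∀ n (K : NonemptyCompacts X), (G n K : Set X) = f n '' ↑K) :
    MultiSensitive f F ↔ MultiSensitive G F := by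
  classical
  constructor
  · rintro ⟨δ, hδ, h⟩
    refine ⟨δ / 4, by positivity, fun k hk A ε hε => ?_⟩
    choose S hSA hne hcov using fun i => net_aux (A i) (ε / 3) (by positivity)
    have hT : (Finset.univ.biUnion S).Nonempty := by
      obtain ⟨s, hs⟩ := hne ⟨0, hk⟩
      exact ⟨s, Finset.mem_biUnion.2 ⟨_, Finset.mem_univ _, hs⟩⟩
    refine hFam.1 _ _ ?_ (finset_aux f F δ h _ hT (ε / 3) (by positivity))
    intro n hn
    refine Set.mem_iInter.2 fun i => ?_
    exact forward_aux f G hG (A i) ε δ hε hδ (S i) (hSA i) (S i).finite_toSet (hne i) (hcov i) n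
      fun x hx => hn x (Finset.mem_biUnion.2 ⟨i, Finset.mem_univ _, hx⟩)
  · rintro ⟨δ, hδ, h⟩
    refine ⟨δ, hδ, fun k hk x ε hε => ?_⟩
    refine hFam.1 _ _ ?_ (h k hk (fun i => {x i}) ε hε)
    exact Set.iInter_mono fun i n hn => backward_aux f G hG (x i) ε δ hδ n hn
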